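/- Let c ∈ ℝ^m⟨⟨X⟩⟩ satisfy |(c, η)| ≤ K_c M_c^{|η|} for all η ∈ X* with constants K_c, M_c > 0 (global convergence), and let c^{-1} be its composition inverse (the unique series with c^{-1} = (−c) ∘̃ c^{-1}). Then there exists K > 0 such that |(c^{-1}, η)| ≤ K (ℬ(K_c) M_c)^{|η|} |η|! for all η ∈ X*, where ℬ(K_c) = 1 / ln(1 + 1/(m K_c)). Moreover, this geometric growth constant is sharp for the class of series with growth constants K_c, M_c: no constant smaller than ℬ(K_c) M_c satisfies such a bound for every series in the class. In particular c^{-1} is locally convergent. -/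

import Mathlib

open scoped BigOperators

/-- A word over the alphabet `X = {x_0, x_1, …, x_m}`. -/
abbrev Word (m : ℕ) := List (Fin (m+1))

/-- A formal power series in `ℝ⟨⟨X⟩⟩`. -/
abbrev Series (m : ℕ) := Word m → ℝ

/-- A formal power series in `ℝ^l⟨⟨X⟩⟩`. -/
abbrev SeriesVec (l m : ℕ) := Fin l → Series m

/-- The shuffle product on `ℝ⟨⟨X⟩⟩`, defined via the coefficient recursion
`(c ⧢ d, x_i η) = (c^{x_i} ⧢ d, η) + (c ⧢ d^{x_i}, η)` which is the bilinear
extension of `(x_i η) ⧢ (x_j ξ) = x_i (η ⧢ (x_j ξ)) + x_j ((x_i η) ⧢ ξ)`. -/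
def shuffle {m : ℕ} : Series m → Series m → Series m
  | c, d, [] => c [] * d []
  | c, d, i :: η => shuffle (fun w => c (i :: w)) d η + shuffle c (fun w => d (i :: w)) η

/-- `x_ℓ c` : prepend the letter `x_ℓ` to every word of `c`. -/
def prepend {m : ℕ} (ℓ : Fin (m+1)) (c : Series m) : Series m
  | [] => 0
  | j :: w => if j = ℓ then c w else 0

/-- The left quotient `c^{x_ℓ}` : `(c^{x_ℓ}, η) = (c, x_ℓ η)`. -/
def leftQuot {m : ℕ} (ℓ : Fin (m+1)) (c : Series m) : Series m :=
  fun w => c (ℓ :: w)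

/-- The series `1∅`. -/
def oneSeries {m : ℕ} : Series m := fun w => if w = [] then 1 else 0

/-- The constant series `K∅`. -/
def constSeries {m : ℕ} (K : ℝ) : Series m := fun w => if w = [] then K else 0

/-- The component `d_ℓ` of `d ∈ ℝ^m⟨⟨X⟩⟩` indexed by letters, with `d_0 := 0`. -/
def dhat {m : ℕ} (d : Fin m → Series m) (ℓ : Fin (m+1)) : Series m :=
  Fin.cases (motive := fun _ => Series m) 0 d ℓ

/-- The component `d_ℓ` of `d ∈ ℝ^m⟨⟨X⟩⟩` indexed by letters, with `d_0 := 1`. -/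
def dtil {m : ℕ} (d : Fin m → Series m) (ℓ : Fin (m+1)) : Series m :=
  Fin.cases (motive := fun _ => Series m) oneSeries d ℓ

/-- `φ_d(x_ℓ)(e) = x_ℓ e + x_0 (d_ℓ ⧢ e)` with `d_0 := 0`. -/
def phiLetter {m : ℕ} (d : Fin m → Series m) (ℓ : Fin (m+1)) (e : Series m) : Series m :=
  prepend ℓ e + prepend 0 (shuffle (dhat d ℓ) e)

/-- `φ_d(η)` for a word `η`, with `φ_d(∅) = id` and `φ_d(x_ℓ η) = φ_d(x_ℓ) ∘ φ_d(η)`. -/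
def phi {m : ℕ} (d : Fin m → Series m) : Word m → Series m → Series m
  | [], e => e
  | ℓ :: η, e => phiLetter d ℓ (phi d η e)

/-- The modified composition product `c ∘̃ d = Σ_{η ∈ X*} (c, η) φ_d(η)(1)`.
Since `φ_d(η)(1)` has no words of length `< |η|`, the coefficient of a word `ν`
is given by the (finite) sum over all words `η` with `|η| ≤ |ν|`. -/
def modComp {m : ℕ} (c : Series m) (d : Fin m → Series m) : Series m :=
  fun ν => ∑ k ∈ Finset.range (ν.length + 1), ∑ η : Fin k → Fin (m+1),
    c (List.ofFn η) * phi d (List.ofFn η) oneSeries ν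

/-- The modified composition product on `ℝ^l⟨⟨X⟩⟩`, componentwise. -/
def modCompVec {l m : ℕ} (c : SeriesVec l m) (d : SeriesVec m m) : SeriesVec l m :=
  fun i => modComp (c i) d

/-- `ψ_d(x_ℓ)(e) = x_0 (d_ℓ ⧢ e)` with `d_0 := 1`. -/
def psiLetter {m : ℕ} (d : Fin m → Series m) (ℓ : Fin (m+1)) (e : Series m) : Series m :=
  prepend 0 (shuffle (dtil d ℓ) e)

/-- `ψ_d(η)` for a word `η`, with `ψ_d(∅) = id` and `ψ_d(x_ℓ η) = ψ_d(x_ℓ) ∘ ψ_d(η)`. -/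
def psi {m : ℕ} (d : Fin m → Series m) : Word m → Series m → Series m
  | [], e => e
  | ℓ :: η, e => psiLetter d ℓ (psi d η e)

/-- The composition product `c ∘ d = Σ_{η ∈ X*} (c, η) ψ_d(η)(1)`. -/
def comp {m : ℕ} (c : Series m) (d : Fin m → Series m) : Series m :=
  fun ν => ∑ k ∈ Finset.range (ν.length + 1), ∑ η : Fin k → Fin (m+1),
    c (List.ofFn η) * psi d (List.ofFn η) oneSeries ν

/-- The composition product on `ℝ^l⟨⟨X⟩⟩`, componentwise. -/
def compVec {l m : ℕ} (c : SeriesVec l m) (d : SeriesVec m m) : SeriesVec l m :=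
  fun i => comp (c i) d

/-- The group product `c ⊚ d := d + c ∘̃ d` of the output feedback group,
so that `(δ + c) ∘ (δ + d) = δ + c ⊚ d`. -/
def oplus {m : ℕ} (c d : SeriesVec m m) : SeriesVec m m :=
  d + modCompVec c d

/-- `ℬ(K_c) = 1 / ln(1 + 1/(m K_c))`. -/
noncomputable def gainB (m : ℕ) (Kc : ℝ) : ℝ :=
  1 / Real.log (1 + 1 / (m * Kc))

section ShuffleAlgebra

variable {m : ℕ}

lemma shuffle_congr (a a' b b' : Series m) (ν : Word m)
    (ha : ∀ w : Word m, w.length ≤ ν.length → a w = a' w)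
    (hb : ∀ w : Word m, w.length ≤ ν.length → b w = b' w) :
    shuffle a b ν = shuffle a' b' ν := by
  induction ν generalizing a a' b b' with
  | nil => simp [shuffle, ha [] le_rfl, hb [] le_rfl]
  | cons i ν ih =>
    simp only [List.length_cons] at ha hb
    simp only [shuffle]
    congr 1
    · exact ih _ _ _ _ (fun w hw => ha _ (by simpa using hw)) fun w hw => hb _ (by omega)
    · exact ih _ _ _ _ (fun w hw => ha _ (by omega)) fun w hw => hb _ (by simpa using hw)

/-- The shuffle product is monotone for coefficientwise domination. -/
lemma abs_shuffle_le (a a' b b' : Series m) (ν : Word m)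
    (ha : ∀ w : Word m, w.length ≤ ν.length → |a w| ≤ a' w)
    (hb : ∀ w : Word m, w.length ≤ ν.length → |b w| ≤ b' w) :
    |shuffle a b ν| ≤ shuffle a' b' ν := by
  induction ν generalizing a a' b b' with
  | nil =>
    simp only [shuffle, abs_mul]
    exact mul_le_mul (ha [] le_rfl) (hb [] le_rfl) (abs_nonneg _)
      ((abs_nonneg _).trans (ha [] le_rfl))
  | cons i ν ih =>
    simp only [List.length_cons] at ha hb
    simp only [shuffle]
    refine (abs_add_le _ _).trans (add_le_add ?_ ?_)
    · exact ih _ _ _ _ (fun w hw => ha _ (by simpa using hw)) fun w hw => hb _ (by omega)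
    · exact ih _ _ _ _ (fun w hw => ha _ (by omega)) fun w hw => hb _ (by simpa using hw)

lemma shuffle_sum_right {ι : Type*} (s : Finset ι) (a : Series m) (r : ι → ℝ)
    (b : ι → Series m) (ν : Word m) :
    shuffle a (fun w => ∑ i ∈ s, r i * b i w) ν = ∑ i ∈ s, r i * shuffle a (b i) ν := by
  induction ν generalizing a b with
  | nil =>
    simp only [shuffle, Finset.mul_sum]
    exact Finset.sum_congr rfl fun i _ => by ring
  | cons j ν ih =>
    simp only [shuffle, ih, ← Finset.sum_add_distrib, mul_add]

lemma shuffle_const_mul_right (r : ℝ) (a b : Series m) (ν : Word m) :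
    shuffle a (fun w => r * b w) ν = r * shuffle a b ν := by
  simpa using shuffle_sum_right {()} a (fun _ => r) (fun _ => b) ν

lemma shuffle_zero_left (b : Series m) (ν : Word m) : shuffle 0 b ν = 0 := by
  induction ν generalizing b with
  | nil => simp [shuffle]
  | cons j ν ih =>
    simp only [shuffle, ih, add_zero]
    exact ih b

end ShuffleAlgebra

section ModifiedComposition

variable {m : ℕ}

lemma phi_cons_apply_cons (d : Fin m → Series m) (ℓ j : Fin (m + 1)) (η ν : Word m) (e : Series m) :
    phi d (ℓ :: η) e (j :: ν) = (if j = ℓ then phi d η e ν else 0) +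
      if j = 0 then shuffle (dhat d ℓ) (phi d η e) ν else 0 := rfl

lemma phi_oneSeries_eq_zero (d : Fin m → Series m) (η ν : Word m) (h : ν.length < η.length) :
    phi d η oneSeries ν = 0 := by
  induction η generalizing ν with
  | nil => simp at h
  | cons ℓ η ih =>
    cases ν with
    | nil => simp [phi, phiLetter, prepend]
    | cons j ν =>
      simp only [List.length_cons, add_lt_add_iff_right] at h
      have hs : shuffle (dhat d ℓ) (phi d η oneSeries) ν = 0 := by
        rw [shuffle_congr _ (dhat d ℓ) _ (fun w => 0 * phi d η oneSeries w) ν (fun _ _ => rfl)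
          fun w hw => by rw [ih w (by omega), zero_mul], shuffle_const_mul_right, zero_mul]
      simp [phi_cons_apply_cons, ih ν h, hs]

lemma modComp_eq_sum (c : Series m) (d : Fin m → Series m) (ν : Word m) (N : ℕ)
    (hN : ν.length < N) :
    modComp c d ν = ∑ k ∈ Finset.range N, ∑ η : Fin k → Fin (m + 1),
      c (List.ofFn η) * phi d (List.ofFn η) oneSeries ν := by
  unfold modComp
  refine Finset.sum_subset (Finset.range_subset_range.2 hN) fun k _ hk => ?_
  refine Finset.sum_eq_zero fun η _ => ?_
  rw [phi_oneSeries_eq_zero, mul_zero]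
  simp only [Finset.mem_range] at hk
  simp only [List.length_ofFn]
  omega

lemma modComp_nil (c : Series m) (d : Fin m → Series m) : modComp c d [] = c [] := by
  simp [modComp, phi, oneSeries]

lemma shuffle_modComp (a c : Series m) (d : Fin m → Series m) (ν : Word m) :
    shuffle a (modComp c d) ν = ∑ k ∈ Finset.range (ν.length + 1), ∑ η : Fin k → Fin (m + 1),
      c (List.ofFn η) * shuffle a (phi d (List.ofFn η) oneSeries) ν := by
  rw [shuffle_congr a a _ (fun w => ∑ k ∈ Finset.range (ν.length + 1), 1 *
    ∑ η : Fin k → Fin (m + 1), c (List.ofFn η) * phi d (List.ofFn η) oneSeries w) ν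
    (fun _ _ => rfl) fun w hw => by simpa using modComp_eq_sum c d w _ (by omega),
    shuffle_sum_right]
  simp_rw [one_mul]
  exact Finset.sum_congr rfl fun k _ => shuffle_sum_right _ _ _ _ _

/-- The left quotients of a modified composition product. -/
lemma modComp_cons (c : Series m) (d : Fin m → Series m) (j : Fin (m + 1)) (ν : Word m) :
    modComp c d (j :: ν) = modComp (leftQuot j c) d ν +
      if j = 0 then ∑ ℓ, shuffle (dhat d ℓ) (modComp (leftQuot ℓ c) d) ν else 0 := by
  have hsplit : ∀ k : ℕ, ∑ η : Fin (k + 1) → Fin (m + 1),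
      c (List.ofFn η) * phi d (List.ofFn η) oneSeries (j :: ν) =
      ∑ η : Fin k → Fin (m + 1), leftQuot j c (List.ofFn η) * phi d (List.ofFn η) oneSeries ν +
      if j = 0 then ∑ ℓ, ∑ η : Fin k → Fin (m + 1), leftQuot ℓ c (List.ofFn η) *
        shuffle (dhat d ℓ) (phi d (List.ofFn η) oneSeries) ν else 0 := by
    intro k
    rw [← Fintype.sum_equiv (Fin.consEquiv fun _ : Fin (k + 1) => Fin (m + 1))
      (fun p => c (p.1 :: List.ofFn p.2) * phi d (p.1 :: List.ofFn p.2) oneSeries (j :: ν)) _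
      (fun p => by simp [Fin.consEquiv, List.ofFn_succ]), Fintype.sum_prod_type]
    simp only [phi_cons_apply_cons, mul_add, Finset.sum_add_distrib, leftQuot]
    congr 1
    · rw [Finset.sum_eq_single j] <;> simp +contextual [eq_comm]
    · split_ifs <;> simp
  unfold modComp
  rw [List.length_cons, Finset.sum_range_succ']
  simp only [hsplit, Finset.sum_add_distrib]
  have h0 : ∑ η : Fin 0 → Fin (m + 1),
      c (List.ofFn η) * phi d (List.ofFn η) oneSeries (j :: ν) = 0 := by
    simp [phi, oneSeries]
  rw [h0, add_zero]
  congr 1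
  split_ifs with hj
  · rw [Finset.sum_comm]
    exact Finset.sum_congr rfl fun ℓ _ => (shuffle_modComp _ _ _ _).symm
  · simp

lemma sum_shuffle_dhat (d : Fin m → Series m) (e : Fin (m + 1) → Series m) (ν : Word m) :
    ∑ ℓ, shuffle (dhat d ℓ) (e ℓ) ν = ∑ i : Fin m, shuffle (d i) (e i.succ) ν := by
  rw [Fin.sum_univ_succ]
  simp [dhat, shuffle_zero_left]

end ModifiedComposition

section Majorant

open Polynomial

/-- The vector fields attached to the letters by the scalar system
`y' = M y (1 + Σ uᵢ + m y)`, which realizes the extremal composition inverse. -/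
noncomputable def extremalField (m : ℕ) (M : ℝ) (j : Fin (m + 1)) : ℝ[X] :=
  C M * X + if j = 0 then C (M * m) * X ^ 2 else 0

/-- The generating series of the extremal system with initial state `K` and output `p`:
its coefficients are the iterated Lie derivatives of `p` evaluated at `K`. -/
noncomputable def lieSeries (m : ℕ) (K M : ℝ) : ℝ[X] → Series m
  | p, [] => p.eval K
  | p, j :: η => lieSeries m K M (extremalField m M j * derivative p) η

variable {m : ℕ} {K M : ℝ}

lemma lieSeries_add (p q : ℝ[X]) (η : Word m) :
    lieSeries m K M (p + q) η = lieSeries m K M p η + lieSeries m K M q η := by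
  induction η generalizing p q with
  | nil => simp [lieSeries]
  | cons j η ih => simp only [lieSeries, derivative_add, mul_add, ih]

lemma lieSeries_C_mul (r : ℝ) (p : ℝ[X]) (η : Word m) :
    lieSeries m K M (C r * p) η = r * lieSeries m K M p η := by
  induction η generalizing p with
  | nil => simp [lieSeries]
  | cons j η ih => simp only [lieSeries, derivative_C_mul, mul_left_comm _ (C r), ih]

/-- Products of outputs correspond to shuffle products of generating series. -/
lemma lieSeries_mul (p q : ℝ[X]) (η : Word m) :
    lieSeries m K M (p * q) η = shuffle (lieSeries m K M p) (lieSeries m K M q) η := by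
  induction η generalizing p q with
  | nil => simp [lieSeries, shuffle]
  | cons j η ih =>
    simp only [lieSeries, shuffle]
    rw [derivative_mul, mul_add, lieSeries_add, ← mul_assoc, ih, mul_left_comm, ih]

/-- The extremal composition inverse. -/
noncomputable def extremalSeries (m : ℕ) (K M : ℝ) : Series m := lieSeries m K M X

lemma extremalSeries_nil : extremalSeries m K M [] = K := by
  simp [extremalSeries, lieSeries]

lemma extremalSeries_cons (j : Fin (m + 1)) (ν : Word m) :
    extremalSeries m K M (j :: ν) = M * extremalSeries m K M ν +
      if j = 0 then m * (M * shuffle (extremalSeries m K M) (extremalSeries m K M) ν) else 0 := by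
  simp only [extremalSeries, lieSeries, extremalField, derivative_X, mul_one, lieSeries_add,
    lieSeries_C_mul]
  split_ifs with hj
  · rw [lieSeries_C_mul, sq, lieSeries_mul]
    ring
  · simpa using lieSeries_C_mul (K := K) (M := M) 0 0 ν

lemma modComp_geometric_extremalSeries (hK : K ≠ 0) (κ : ℝ) (ν : Word m) :
    modComp (fun η => κ * M ^ η.length) (fun _ => extremalSeries m K M) ν =
      κ / K * extremalSeries m K M ν := by
  induction hn : ν.length using Nat.strong_induction_on generalizing ν κ with
  | _ n ih =>
    subst hn
    cases ν with
    | nil => simp [modComp_nil, extremalSeries_nil, hK]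
    | cons j ν =>
      have hq : ∀ ℓ : Fin (m + 1), leftQuot ℓ (fun η : Word m => κ * M ^ η.length) =
          fun η => κ * M * M ^ η.length := by
        intro ℓ
        funext η
        simp only [leftQuot, List.length_cons, pow_succ]
        ring
      have hs : shuffle (extremalSeries m K M) (modComp (fun η => κ * M * M ^ η.length)
          fun _ => extremalSeries m K M) ν =
          κ * M / K * shuffle (extremalSeries m K M) (extremalSeries m K M) ν := by
        rw [← shuffle_const_mul_right]
        exact shuffle_congr _ _ _ _ _ (fun _ _ => rfl)
          fun w hw => ih _ (by simpa [Nat.lt_succ_iff] using hw) _ w rfl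
      rw [modComp_cons, extremalSeries_cons, sum_shuffle_dhat]
      simp only [hq, hs, ih _ (by simp) _ ν rfl, Finset.sum_const, Finset.card_univ,
        Fintype.card_fin, nsmul_eq_mul]
      split_ifs <;> ring

/-- The extremal series dominates every fixed point of `d ↦ c ∘̃ d` for `c` with growth
constants `K`, `M`. -/
lemma abs_modComp_le_extremalSeries (hK : 0 < K) (c d : SeriesVec m m)
    (hc : ∀ (η : Word m) (i : Fin m), |c i η| ≤ K * M ^ η.length) (hd : d = modCompVec c d)
    (ν : Word m) (κ : ℝ) (b : Series m) (hb : ∀ η : Word m, |b η| ≤ κ * M ^ η.length) :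
    |modComp b d ν| ≤ κ / K * extremalSeries m K M ν := by
  induction hn : ν.length using Nat.strong_induction_on generalizing ν κ b with
  | _ n ih =>
    subst hn
    cases ν with
    | nil => simpa [modComp_nil, extremalSeries_nil, hK.ne'] using hb []
    | cons j ν =>
      have hq : ∀ (ℓ : Fin (m + 1)) (η : Word m), |leftQuot ℓ b η| ≤ κ * M * M ^ η.length := by
        intro ℓ η
        refine (hb (ℓ :: η)).trans_eq ?_
        rw [List.length_cons, pow_succ]
        ring
      have hs : ∀ i : Fin m, |shuffle (d i) (modComp (leftQuot i.succ b) d) ν| ≤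
          κ * M / K * shuffle (extremalSeries m K M) (extremalSeries m K M) ν := by
        intro i
        rw [← shuffle_const_mul_right]
        refine abs_shuffle_le _ _ _ _ _ (fun w hw => ?_)
          fun w hw => ih _ (by simpa [Nat.lt_succ_iff] using hw) w _ _ (hq _) rfl
        have := ih _ (by simpa [Nat.lt_succ_iff] using hw) w K (c i) (fun η => hc η i) rfl
        rw [div_self hK.ne', one_mul] at this
        rwa [hd]
      rw [modComp_cons, extremalSeries_cons, sum_shuffle_dhat]
      refine (abs_add_le _ _).trans ?_
      rw [mul_add]
      refine add_le_add ((ih _ (by simp) ν _ _ (hq j) rfl).trans_eq (by ring)) ?_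
      split_ifs
      · refine (Finset.abs_sum_le_sum_abs _ _).trans
          ((Finset.sum_le_sum fun i _ => hs i).trans_eq ?_)
        simp only [Finset.sum_const, Finset.card_univ, Fintype.card_fin, nsmul_eq_mul]
        ring
      · simp

lemma coeff_extremalField_nonneg (hM : 0 ≤ M) (j : Fin (m + 1)) (n : ℕ) :
    0 ≤ (extremalField m M j).coeff n := by
  unfold extremalField
  split_ifs
  · simp only [coeff_add, coeff_C_mul, coeff_X, coeff_X_pow]
    positivity
  · simp only [add_zero, coeff_C_mul, coeff_X]
    positivity

lemma coeff_mul_nonneg_of_nonneg {p q : ℝ[X]} (hp : ∀ n, 0 ≤ p.coeff n)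
    (hq : ∀ n, 0 ≤ q.coeff n) (n : ℕ) : 0 ≤ (p * q).coeff n := by
  rw [coeff_mul]
  exact Finset.sum_nonneg fun x _ => mul_nonneg (hp _) (hq _)

lemma coeff_derivative_nonneg_of_nonneg {p : ℝ[X]} (hp : ∀ n, 0 ≤ p.coeff n) (n : ℕ) :
    0 ≤ (derivative p).coeff n := by
  rw [coeff_derivative]
  exact mul_nonneg (hp _) (by positivity)

lemma lieSeries_nonneg (hK : 0 ≤ K) (hM : 0 ≤ M) (p : ℝ[X]) (hp : ∀ n, 0 ≤ p.coeff n)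
    (η : Word m) : 0 ≤ lieSeries m K M p η := by
  induction η generalizing p with
  | nil =>
    rw [lieSeries, eval_eq_sum_range]
    exact Finset.sum_nonneg fun i _ => mul_nonneg (hp i) (pow_nonneg hK i)
  | cons j η ih =>
    exact ih _ (coeff_mul_nonneg_of_nonneg (coeff_extremalField_nonneg hM j)
      (coeff_derivative_nonneg_of_nonneg hp))

/-- Among words of a given length, the largest coefficient is attained at a power of `x_0`. -/
lemma lieSeries_le_replicate (hK : 0 ≤ K) (hM : 0 ≤ M) (p : ℝ[X]) (hp : ∀ n, 0 ≤ p.coeff n)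
    (η : Word m) : lieSeries m K M p η ≤ lieSeries m K M p (List.replicate η.length 0) := by
  induction η generalizing p with
  | nil => simp
  | cons j η ih =>
    have hp' := coeff_derivative_nonneg_of_nonneg hp
    simp only [List.length_cons, List.replicate_succ, lieSeries]
    refine (ih _ (coeff_mul_nonneg_of_nonneg (coeff_extremalField_nonneg hM j) hp')).trans ?_
    by_cases hj : j = 0
    · rw [hj]
    · have hsplit : extremalField m M 0 = extremalField m M j + C (M * m) * X ^ 2 := by
        simp [extremalField, hj]
      rw [hsplit, add_mul, lieSeries_add, le_add_iff_nonneg_right]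
      refine lieSeries_nonneg hK hM _ (coeff_mul_nonneg_of_nonneg (fun n => ?_) hp') _
      rw [coeff_C_mul, coeff_X_pow]
      positivity

/-- Along powers of `x_0` the generating series is the Taylor series of the output along the
solution `Z` of the unforced system. -/
lemma lieSeries_replicate (Z : PowerSeries ℝ) (hZ0 : PowerSeries.constantCoeff Z = K)
    (hZ : PowerSeries.derivative ℝ Z = aeval Z (extremalField m M 0)) (p : ℝ[X]) (n : ℕ) :
    lieSeries m K M p (List.replicate n 0) = n.factorial * PowerSeries.coeff n (aeval Z p) := by
  induction n generalizing p with
  | zero =>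
    simp only [List.replicate_zero, lieSeries, Nat.factorial_zero, Nat.cast_one, one_mul,
      PowerSeries.coeff_zero_eq_constantCoeff]
    rw [aeval_def, hom_eval₂, hZ0, eval, eval₂_congr _ rfl rfl]
    ext r
    simp
  | succ n ih =>
    rw [List.replicate_succ, lieSeries, ih, map_mul, ← hZ, mul_comm (PowerSeries.derivative ℝ Z),
      ← smul_eq_mul (aeval Z (derivative p)), ← Derivation.map_aeval, PowerSeries.coeff_derivative,
      Nat.factorial_succ]
    push_cast
    ring

end Majorant

section UnforcedSolution

open PowerSeries

/-- The power series of `e^{M t}`. -/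
noncomputable def expMul (M : ℝ) : PowerSeries ℝ := PowerSeries.mk fun n => M ^ n / n.factorial

lemma derivative_expMul (M : ℝ) : derivative ℝ (expMul M) = C M * expMul M := by
  ext n
  rw [coeff_derivative, coeff_C_mul, expMul, coeff_mk, coeff_mk, Nat.factorial_succ]
  push_cast
  field_simp
  ring

/-- The power series of `(Q / m) / (Q - e^{M t})`; for `Q = 1 + 1 / (m K)` it is `1 / m` plus
the solution of `z' = M z (1 + m z)`, `z 0 = K`. -/
noncomputable def shiftedSolution (m : ℕ) (Q M : ℝ) : PowerSeries ℝ :=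
  C (Q / m) * (C Q - expMul M)⁻¹

variable {m : ℕ} {Q M : ℝ}

lemma constantCoeff_expMul : constantCoeff (expMul M) = 1 := by
  simp [expMul, ← coeff_zero_eq_constantCoeff_apply]

lemma shiftedSolution_mul (hQ : 1 < Q) :
    shiftedSolution m Q M * (C Q - expMul M) = C (Q / m) := by
  rw [shiftedSolution, mul_assoc, PowerSeries.inv_mul_cancel, mul_one]
  rw [map_sub, constantCoeff_expMul, constantCoeff_C]
  exact (sub_pos.2 hQ).ne'

lemma constantCoeff_shiftedSolution (hQ : 1 < Q) :
    constantCoeff (shiftedSolution m Q M) = Q / m / (Q - 1) := by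
  have h := congrArg constantCoeff (shiftedSolution_mul (m := m) (M := M) hQ)
  rw [map_mul, map_sub, constantCoeff_expMul, constantCoeff_C, constantCoeff_C] at h
  exact eq_div_of_mul_eq (sub_pos.2 hQ).ne' h

lemma derivative_shiftedSolution (hm : 0 < m) (hQ : 1 < Q) :
    derivative ℝ (shiftedSolution m Q M) =
      C M * (shiftedSolution m Q M - C (1 / (m : ℝ))) +
        C (M * m) * (shiftedSolution m Q M - C (1 / (m : ℝ))) ^ 2 := by
  have hm' : (m : ℝ) ≠ 0 := by positivity
  have hinv : (C Q - expMul M)⁻¹ * (C Q - expMul M) = 1 := by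
    refine PowerSeries.inv_mul_cancel _ ?_
    rw [map_sub, constantCoeff_expMul, constantCoeff_C]
    exact (sub_pos.2 hQ).ne'
  have hCm : C (1 / (m : ℝ)) * C (m : ℝ) = 1 := by
    rw [← map_mul, one_div_mul_cancel hm', map_one]
  have hQm : C (Q / m) = C Q * C (1 / (m : ℝ)) := by rw [← map_mul]; congr 1; ring
  rw [shiftedSolution, Derivation.leibniz, derivative_C, derivative_inv', map_sub, derivative_C,
    derivative_expMul, hQm, map_mul C M]
  simp only [smul_eq_mul, mul_zero, add_zero, zero_sub]
  set V := (C Q - expMul M)⁻¹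
  set E := expMul M
  set a := C (1 / (m : ℝ))
  set b : PowerSeries ℝ := C (m : ℝ)
  set q := C Q
  set μ := C M
  have hE : E * V = q * V - 1 := by linear_combination -hinv
  linear_combination (q * a * μ * V) * hE - μ * a * (q * V - 1) ^ 2 * hCm

lemma shiftedSolution_recursion (hQ : 1 < Q) (n : ℕ) (hn : n ≠ 0) :
    (Q - 1) * coeff n (shiftedSolution m Q M) =
      ∑ k ∈ Finset.range n, coeff (n - (k + 1)) (shiftedSolution m Q M) *
        (M ^ (k + 1) / (k + 1).factorial) := by
  have h := congrArg (coeff n) (shiftedSolution_mul (m := m) (M := M) hQ)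
  rw [mul_sub, map_sub, mul_comm, coeff_C_mul, coeff_C, if_neg hn, mul_comm _ (expMul M),
    coeff_mul, Finset.Nat.sum_antidiagonal_eq_sum_range_succ_mk, Finset.sum_range_succ'] at h
  simp only [expMul, coeff_mk, pow_zero, Nat.factorial_zero, Nat.cast_one, Nat.sub_zero] at h
  rw [Finset.sum_congr rfl fun k _ => mul_comm _ _]
  linarith

lemma coeff_shiftedSolution_le (hQ : 1 < Q) (hM : 0 < M) (n : ℕ) :
    coeff n (shiftedSolution m Q M) ≤ Q / m / (Q - 1) * (1 / Real.log Q * M) ^ n := by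
  have hL : 0 < Real.log Q := Real.log_pos hQ
  have hQ1 : 0 < Q - 1 := sub_pos.2 hQ
  have hW : 0 ≤ Q / m / (Q - 1) := by positivity
  induction n using Nat.strong_induction_on with
  | _ n ih =>
    rcases Nat.eq_zero_or_pos n with rfl | hn
    · rw [coeff_zero_eq_constantCoeff_apply, constantCoeff_shiftedSolution hQ]
      simp
    · refine le_of_mul_le_mul_left ?_ hQ1
      rw [shiftedSolution_recursion hQ n hn.ne']
      have hexp : ∑ k ∈ Finset.range n, Real.log Q ^ (k + 1) / (k + 1).factorial ≤ Q - 1 := by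
        have h := Real.sum_le_exp_of_nonneg hL.le (n + 1)
        rw [Finset.sum_range_succ', Real.exp_log (by linarith)] at h
        simp only [pow_zero, Nat.factorial_zero, Nat.cast_one, div_one] at h
        linarith
      calc _ ≤ ∑ k ∈ Finset.range n, Q / m / (Q - 1) * (1 / Real.log Q * M) ^ n *
            (Real.log Q ^ (k + 1) / (k + 1).factorial) := by
            refine Finset.sum_le_sum fun k hk => ?_
            have hk' : k + 1 ≤ n := Finset.mem_range.1 hk
            refine (mul_le_mul_of_nonneg_right (ih _ (by omega)) (by positivity)).trans_eq ?_
            have hpow : (1 / Real.log Q * M) ^ n =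
                (1 / Real.log Q * M) ^ (n - (k + 1)) * (1 / Real.log Q * M) ^ (k + 1) := by
              rw [← pow_add, Nat.sub_add_cancel hk']
            have hLM : (1 / Real.log Q * M) ^ (k + 1) * Real.log Q ^ (k + 1) = M ^ (k + 1) := by
              rw [← mul_pow]
              congr 1
              field_simp
            rw [hpow, ← hLM]
            ring
        _ ≤ Q / m / (Q - 1) * (1 / Real.log Q * M) ^ n * (Q - 1) := by
            rw [← Finset.mul_sum]
            exact mul_le_mul_of_nonneg_left hexp (by positivity)
        _ = _ := by ring

/-- The coefficients of the unforced solution grow at least at the rate given by its pole. -/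
lemma not_coeff_shiftedSolution_le (hm : 0 < m) (hQ : 1 < Q) (hM : 0 < M) (M' K' : ℝ)
    (hM' : 0 < M') (hlt : M' < 1 / Real.log Q * M)
    (h : ∀ n, |coeff n (shiftedSolution m Q M)| ≤ K' * M' ^ n) : False := by
  have hL : 0 < Real.log Q := Real.log_pos hQ
  set R := Real.log Q / M with hR
  have hRpos : 0 < R := by positivity
  have hMR : M' * R < 1 := by
    calc M' * R < 1 / Real.log Q * M * R := mul_lt_mul_of_pos_right hlt hRpos
      _ = 1 := by rw [hR]; field_simp
  have hf : Summable fun n => ‖coeff n (shiftedSolution m Q M) * R ^ n‖ := by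
    refine Summable.of_nonneg_of_le (fun _ => norm_nonneg _) (fun n => ?_)
      ((summable_geometric_of_lt_one (by positivity) hMR).mul_left K')
    rw [norm_mul, Real.norm_eq_abs, Real.norm_of_nonneg (by positivity), mul_pow, ← mul_assoc]
    exact mul_le_mul_of_nonneg_right (h n) (by positivity)
  have hexp : HasSum (fun n => coeff n (C Q - expMul M) * R ^ n) 0 := by
    have h1 := NormedSpace.expSeries_div_hasSum_exp (Real.log Q)
    rw [← Real.exp_eq_exp_ℝ, Real.exp_log (by linarith)] at h1
    have h2 := (hasSum_ite_eq 0 Q).sub h1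
    rw [sub_self] at h2
    have hcoeff : (fun n => coeff n (C Q - expMul M) * R ^ n) =
        fun n => (if n = 0 then Q else 0) - Real.log Q ^ n / n.factorial := by
      funext n
      rw [map_sub, coeff_C, expMul, coeff_mk, sub_mul, hR, div_pow]
      congr 1
      · split_ifs with h0 <;> simp [h0]
      · field_simp
    rwa [hcoeff]
  have hg : Summable fun n => ‖coeff n (C Q - expMul M) * R ^ n‖ := hexp.summable.norm
  have hprod := tsum_mul_tsum_eq_tsum_sum_antidiagonal_of_summable_norm hf hg
  have hterm : ∀ n, ∑ kl ∈ Finset.HasAntidiagonal.antidiagonal n, coeff kl.1 (shiftedSolution m Q M) * R ^ kl.1 *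
      (coeff kl.2 (C Q - expMul M) * R ^ kl.2) = if n = 0 then Q / m else 0 := by
    intro n
    have hc := congrArg (coeff n) (shiftedSolution_mul (m := m) (M := M) hQ)
    rw [coeff_mul, coeff_C] at hc
    calc _ = (if n = 0 then Q / m else 0) * R ^ n := by
          rw [← hc, Finset.sum_mul]
          refine Finset.sum_congr rfl fun kl hkl => ?_
          rw [← Finset.HasAntidiagonal.mem_antidiagonal.1 hkl, pow_add]
          ring
      _ = _ := by split_ifs with h0 <;> simp [h0]
  rw [hexp.tsum_eq, mul_zero, tsum_congr hterm, tsum_ite_eq] at hprod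
  have : 0 < Q / m := by positivity
  linarith

end UnforcedSolution

lemma extremalSeries_replicate {m : ℕ} {K M : ℝ} (hm : 0 < m) (hK : 0 < K) (n : ℕ) :
    extremalSeries m K M (List.replicate n 0) = n.factorial *
      PowerSeries.coeff n (shiftedSolution m (1 + 1 / (m * K)) M -
        PowerSeries.C (1 / (m : ℝ))) := by
  have hm' : (0 : ℝ) < m := by positivity
  have hQ : 1 < 1 + 1 / (m * K) := lt_add_of_pos_right _ (by positivity)
  rw [extremalSeries, lieSeries_replicate (shiftedSolution m (1 + 1 / (m * K)) M -
    PowerSeries.C (1 / (m : ℝ))), Polynomial.aeval_X]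
  · rw [map_sub, constantCoeff_shiftedSolution hQ, PowerSeries.constantCoeff_C]
    field_simp
    ring
  · rw [map_sub, PowerSeries.derivative_C, sub_zero, derivative_shiftedSolution hm hQ]
    simp [extremalField]

/-- if `|(c,η)| ≤ K_c M_c^{|η|}` for all `η` (global convergence),
then the composition inverse satisfies `|(c⁻¹,η)| ≤ K (ℬ(K_c) M_c)^{|η|} |η|!`
for some `K > 0`; moreover no geometric growth constant smaller than
`ℬ(K_c) M_c` works for every series in the class with growth constants
`K_c, M_c`.  In particular `c⁻¹` is locally convergent. -/
theorem compositionInverse_globalCase_radius (m : ℕ) (hm : 0 < m)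
    (Kc Mc : ℝ) (hKc : 0 < Kc) (hMc : 0 < Mc) :
    (∀ c cinv : SeriesVec m m,
      (∀ (η : Word m) (i : Fin m), |c i η| ≤ Kc * Mc ^ η.length) →
      cinv = modCompVec (-c) cinv →
      ∃ K : ℝ, 0 < K ∧ ∀ (η : Word m) (i : Fin m),
        |cinv i η| ≤ K * (gainB m Kc * Mc) ^ η.length * (Nat.factorial η.length : ℝ)) ∧
    (∀ M' : ℝ, 0 < M' → M' < gainB m Kc * Mc →
      ∃ c cinv : SeriesVec m m,
        (∀ (η : Word m) (i : Fin m), |c i η| ≤ Kc * Mc ^ η.length) ∧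
        cinv = modCompVec (-c) cinv ∧
        ¬ ∃ K : ℝ, 0 < K ∧ ∀ (η : Word m) (i : Fin m),
            |cinv i η| ≤ K * M' ^ η.length * (Nat.factorial η.length : ℝ)) := by
  have hm' : (0 : ℝ) < m := by positivity
  have hQ : 1 < 1 + 1 / (m * Kc) := lt_add_of_pos_right _ (by positivity)
  have hW : 0 < (1 + 1 / (m * Kc)) / m / (1 + 1 / (m * Kc) - 1) :=
    div_pos (by positivity) (sub_pos.2 hQ)
  refine ⟨fun c cinv hc hinv => ⟨_, hW, fun η i => ?_⟩, fun M' hM' hlt => ?_⟩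
  · have hdom := abs_modComp_le_extremalSeries hKc (-c) cinv
      (fun η i => by simpa using hc η i) hinv η Kc ((-c) i) fun η => by simpa using hc η i
    rw [div_self hKc.ne', one_mul] at hdom
    have hrep : extremalSeries m Kc Mc η ≤ extremalSeries m Kc Mc (List.replicate η.length 0) :=
      lieSeries_le_replicate hKc.le hMc.le _
        (fun n => by rw [Polynomial.coeff_X]; positivity) η
    rw [hinv]
    refine hdom.trans (hrep.trans ?_)
    rw [extremalSeries_replicate hm hKc, mul_comm]
    refine mul_le_mul_of_nonneg_right (le_trans ?_ (coeff_shiftedSolution_le hQ hMc _))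
      (by positivity)
    rw [map_sub, PowerSeries.coeff_C, sub_le_self_iff]
    positivity
  · refine ⟨fun _ η => -(Kc * Mc ^ η.length), fun _ => extremalSeries m Kc Mc, fun η _ => ?_, ?_,
      ?_⟩
    · rw [abs_neg, abs_of_pos (by positivity)]
    · funext i ν
      have hfix := modComp_geometric_extremalSeries (M := Mc) hKc.ne' Kc ν
      rw [div_self hKc.ne', one_mul] at hfix
      rw [← hfix]
      simp [modCompVec, Pi.neg_def]
    · rintro ⟨K, -, hK⟩
      refine not_coeff_shiftedSolution_le hm hQ hMc M' (K + 1 / m) hM' hlt fun n => ?_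
      have hn := hK (List.replicate n 0) ⟨0, hm⟩
      dsimp only at hn
      rw [extremalSeries_replicate hm hKc, abs_mul, Nat.abs_cast, List.length_replicate,
        mul_comm] at hn
      replace hn := le_of_mul_le_mul_right hn (by positivity)
      rw [map_sub, PowerSeries.coeff_C] at hn
      have htail : |if n = 0 then 1 / (m : ℝ) else 0| ≤ 1 / m * M' ^ n := by
        split_ifs with h0
        · simp [h0]
        · rw [abs_zero]
          positivity
      have htri := abs_sub_abs_le_abs_sub (PowerSeries.coeff n
        (shiftedSolution m (1 + 1 / (m * Kc)) Mc)) (if n = 0 then 1 / (m : ℝ) else 0)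
      linarith
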